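/- A control u* is a global minimizer of the POD-Galerkin reduced cost (J_r(u*) ≤ J_r(v) for every control v) if and only if μ u*(t) + Bᵀ U a_{λ,u*}(t) = 0 for every t ∈ [0, t_f]; moreover, there is at most one such minimizer among continuous controls. -/

import Mathlib

open Matrix MeasureTheory

section LinearQuadratic

variable {ι κ ρ : Type*} [Fintype ι]

theorem ContinuousOn.const_mulVec {s : Set ℝ} {f : ℝ → ι → ℝ} (hf : ContinuousOn f s)
    (M : Matrix κ ι ℝ) : ContinuousOn (fun t => M *ᵥ f t) s :=
  (continuous_const.matrix_mulVec continuous_id).comp_continuousOn hf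

theorem ContinuousOn.dotProduct_real {s : Set ℝ} {f g : ℝ → ι → ℝ} (hf : ContinuousOn f s)
    (hg : ContinuousOn g s) : ContinuousOn (fun t => f t ⬝ᵥ g t) s :=
  (Continuous.dotProduct continuous_fst continuous_snd).comp_continuousOn (hf.prodMk hg)

theorem HasDerivAt.dotProduct_real {f g : ℝ → ι → ℝ} {f' g' : ι → ℝ} {t : ℝ}
    (hf : HasDerivAt f f' t) (hg : HasDerivAt g g' t) :
    HasDerivAt (fun t => f t ⬝ᵥ g t) (f' ⬝ᵥ g t + f t ⬝ᵥ g') t := by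
  simp only [dotProduct, ← Finset.sum_add_distrib]
  exact HasDerivAt.fun_sum fun i _ => (hasDerivAt_pi.1 hf i).mul (hasDerivAt_pi.1 hg i)

theorem dotProduct_self_nonneg_real (x : ι → ℝ) : 0 ≤ x ⬝ᵥ x :=
  Finset.sum_nonneg fun i _ => mul_self_nonneg (x i)

variable [Fintype κ]

theorem HasDerivAt.linear_ode_add_smul {M : Matrix ι ι ℝ} {N : Matrix ι κ ℝ}
    {a d : ℝ → ι → ℝ} {u h : ℝ → κ → ℝ} {t : ℝ} (r s : ℝ)
    (ha : HasDerivAt a (M *ᵥ a t + N *ᵥ u t) t) (hd : HasDerivAt d (M *ᵥ d t + N *ᵥ h t) t) :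
    HasDerivAt (r • a + s • d)
      (M *ᵥ (r • a + s • d) t + N *ᵥ (r • u + s • h) t) t := by
  refine ((ha.const_smul r).add (hd.const_smul s)).congr_deriv ?_
  simp only [Pi.add_apply, Pi.smul_apply, mulVec_add, mulVec_smul, smul_add]
  abel

/-- A continuous nonnegative function with nonpositive integral vanishes. -/
theorem ContinuousOn.eq_zero_of_integral_nonpos {f : ℝ → ℝ} {a b : ℝ} (hab : a < b)
    (hf : ContinuousOn f (Set.Icc a b)) (hf0 : ∀ t ∈ Set.Icc a b, 0 ≤ f t)
    (hint : ∫ t in a..b, f t ≤ 0) : ∀ t ∈ Set.Icc a b, f t = 0 := by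
  intro t ht
  by_contra hne
  exact hint.not_gt <| intervalIntegral.integral_pos hab hf
    (fun s hs => hf0 s (Set.Ioc_subset_Icc_self hs)) ⟨t, ht, (hf0 t ht).lt_of_ne' hne⟩

/-- Variation of constants: a linear system with continuous forcing has a global solution
starting from `0`. -/
theorem exists_hasDerivAt_linear_ode {E : Type*} [NormedAddCommGroup E] [NormedSpace ℝ E]
    [CompleteSpace E] (L : E →L[ℝ] E) {f : ℝ → E} (hf : Continuous f) :
    ∃ d : ℝ → E, d 0 = 0 ∧ ∀ t, HasDerivAt d (L (d t) + f t) t := by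
  let _ : NormedAlgebra ℚ (E →L[ℝ] E) := .restrictScalars ℚ ℝ (E →L[ℝ] E)
  have hcont : Continuous fun s : ℝ => NormedSpace.exp (-(s • L)) (f s) :=
    (NormedSpace.exp_continuous.comp (continuous_id.smul continuous_const).neg).clm_apply hf
  refine ⟨fun t => NormedSpace.exp (t • L) (∫ s in (0 : ℝ)..t, NormedSpace.exp (-(s • L)) (f s)),
    by simp, fun t => ?_⟩
  have hd := (hasDerivAt_exp_smul_const' L t).clm_apply
    (hcont.integral_hasStrictDerivAt 0 t).hasDerivAt
  have hinv : NormedSpace.exp (t • L) * NormedSpace.exp (-(t • L)) = 1 := by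
    rw [← NormedSpace.exp_add_of_commute (Commute.refl (t • L)).neg_right, add_neg_cancel,
      NormedSpace.exp_zero]
  refine hd.congr_deriv ?_
  congr 1
  exact congrArg (fun T : E →L[ℝ] E => T (f t)) hinv

variable [Fintype ρ]

/-- The running cost of a linear-quadratic tracking problem, integrated over `[0, T]`. -/
noncomputable def trackingCost (K : Matrix ρ ι ℝ) (y : ℝ → ρ → ℝ) (μ T : ℝ) (a : ℝ → ι → ℝ)
    (u : ℝ → κ → ℝ) : ℝ :=
  ∫ t in (0 : ℝ)..T, ((K *ᵥ a t - y t) ⬝ᵥ (K *ᵥ a t - y t) + μ * (u t ⬝ᵥ u t))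

variable {M : Matrix ι ι ℝ} {N : Matrix ι κ ℝ} {K : Matrix ρ ι ℝ} {y : ℝ → ρ → ℝ} {μ T : ℝ}

theorem continuousOn_trackingCost {S : Set ℝ} {a : ℝ → ι → ℝ} {u : ℝ → κ → ℝ}
    (ha : ContinuousOn a S) (hu : ContinuousOn u S) (hy : ContinuousOn y S) :
    ContinuousOn
      (fun t => (K *ᵥ a t - y t) ⬝ᵥ (K *ᵥ a t - y t) + μ * (u t ⬝ᵥ u t)) S := by
  have he := (ha.const_mulVec K).sub hy
  exact (he.dotProduct_real he).add (continuousOn_const.mul (hu.dotProduct_real hu))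

theorem trackingCost_zero_nonneg (hμ : 0 ≤ μ) (hT : 0 ≤ T) (a : ℝ → ι → ℝ) (u : ℝ → κ → ℝ) :
    0 ≤ trackingCost K 0 μ T a u :=
  intervalIntegral.integral_nonneg hT fun _ _ =>
    add_nonneg (dotProduct_self_nonneg_real _) (mul_nonneg hμ (dotProduct_self_nonneg_real _))

/-- Along a linear perturbation, the cost is a quadratic polynomial whose linear coefficient is
expressed through the adjoint state. -/
theorem trackingCost_add_smul (hT : 0 ≤ T) (hy : ContinuousOn y (Set.Icc 0 T))
    {a d l : ℝ → ι → ℝ} {u h : ℝ → κ → ℝ}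
    (hu : ContinuousOn u (Set.Icc 0 T)) (hh : ContinuousOn h (Set.Icc 0 T))
    (ha : ContinuousOn a (Set.Icc 0 T)) (hd0 : d 0 = 0)
    (hd : ∀ t ∈ Set.Icc 0 T, HasDerivAt d (M *ᵥ d t + N *ᵥ h t) t) (hlT : l T = 0)
    (hl : ∀ t ∈ Set.Icc 0 T, HasDerivAt l (-(Mᵀ *ᵥ l t + Kᵀ *ᵥ (K *ᵥ a t - y t))) t) (s : ℝ) :
    trackingCost K y μ T (a + s • d) (u + s • h) = trackingCost K y μ T a u
      + 2 * s * (∫ t in (0 : ℝ)..T, (μ • u t + Nᵀ *ᵥ l t) ⬝ᵥ h t)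
      + s ^ 2 * trackingCost K 0 μ T d h := by
  have hdc : ContinuousOn d (Set.Icc 0 T) := fun t ht => (hd t ht).continuousAt.continuousWithinAt
  have hlc : ContinuousOn l (Set.Icc 0 T) := fun t ht => (hl t ht).continuousAt.continuousWithinAt
  have ii {f : ℝ → ℝ} (hf : ContinuousOn f (Set.Icc 0 T)) : IntervalIntegrable f volume 0 T :=
    hf.intervalIntegrable_of_Icc hT
  have hec : ContinuousOn (fun t => K *ᵥ a t - y t) (Set.Icc 0 T) := (ha.const_mulVec K).sub hy
  have hpair : ContinuousOn
      (fun t => (Nᵀ *ᵥ l t) ⬝ᵥ h t - (K *ᵥ a t - y t) ⬝ᵥ (K *ᵥ d t)) (Set.Icc 0 T) :=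
    ((hlc.const_mulVec Nᵀ).dotProduct_real hh).sub (hec.dotProduct_real (hdc.const_mulVec K))
  have hgrad : ContinuousOn (fun t => (μ • u t + Nᵀ *ᵥ l t) ⬝ᵥ h t) (Set.Icc 0 T) :=
    ((hu.const_smul μ).add (hlc.const_mulVec Nᵀ)).dotProduct_real hh
  have hduality : ∫ t in (0 : ℝ)..T,
      ((Nᵀ *ᵥ l t) ⬝ᵥ h t - (K *ᵥ a t - y t) ⬝ᵥ (K *ᵥ d t)) = 0 := by
    rw [intervalIntegral.integral_eq_sub_of_hasDerivAt (f := fun t => l t ⬝ᵥ d t) _ (ii hpair)]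
    · simp [hd0, hlT]
    · intro t ht
      rw [Set.uIcc_of_le hT] at ht
      refine ((hl t ht).dotProduct_real (hd t ht)).congr_deriv ?_
      simp only [neg_dotProduct, add_dotProduct, dotProduct_add, mulVec_transpose,
        ← dotProduct_mulVec]
      ring
  have hcost := ii (continuousOn_trackingCost (K := K) (μ := μ) ha hu hy)
  have hquad := ii (continuousOn_trackingCost (K := K) (μ := μ) (y := 0) hdc hh continuousOn_const)
  calc trackingCost K y μ T (a + s • d) (u + s • h)
      = ∫ t in (0 : ℝ)..T, (((K *ᵥ a t - y t) ⬝ᵥ (K *ᵥ a t - y t) + μ * (u t ⬝ᵥ u t))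
          + 2 * s * ((μ • u t + Nᵀ *ᵥ l t) ⬝ᵥ h t)
          + s ^ 2 * ((K *ᵥ d t - (0 : ℝ → ρ → ℝ) t) ⬝ᵥ (K *ᵥ d t - (0 : ℝ → ρ → ℝ) t)
            + μ * (h t ⬝ᵥ h t))
          - 2 * s * ((Nᵀ *ᵥ l t) ⬝ᵥ h t - (K *ᵥ a t - y t) ⬝ᵥ (K *ᵥ d t))) := by
        refine intervalIntegral.integral_congr fun t _ => ?_
        have hres : K *ᵥ (a t + s • d t) - y t = (K *ᵥ a t - y t) + s • (K *ᵥ d t) := by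
          rw [mulVec_add, mulVec_smul]; abel
        simp only [Pi.add_apply, Pi.smul_apply, hres, Pi.zero_apply, sub_zero]
        generalize K *ᵥ a t - y t = e
        generalize K *ᵥ d t = k
        simp only [add_dotProduct, dotProduct_add, smul_dotProduct, dotProduct_smul, smul_eq_mul,
          dotProduct_comm k e, dotProduct_comm (h t) (u t)]
        ring
    _ = _ := by
        rw [intervalIntegral.integral_sub ((hcost.add ((ii hgrad).const_mul _)).add
            (hquad.const_mul _)) ((ii hpair).const_mul _),
          intervalIntegral.integral_add (hcost.add ((ii hgrad).const_mul _)) (hquad.const_mul _),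
          intervalIntegral.integral_add hcost ((ii hgrad).const_mul _),
          intervalIntegral.integral_const_mul, intervalIntegral.integral_const_mul,
          intervalIntegral.integral_const_mul, hduality]
        simp [trackingCost]

/-- Parallelogram identity for the tracking cost. -/
theorem trackingCost_midpoint (hT : 0 ≤ T) (hy : ContinuousOn y (Set.Icc 0 T))
    {a b : ℝ → ι → ℝ} {u v : ℝ → κ → ℝ}
    (hu : ContinuousOn u (Set.Icc 0 T)) (hv : ContinuousOn v (Set.Icc 0 T))
    (ha : ContinuousOn a (Set.Icc 0 T)) (hb : ContinuousOn b (Set.Icc 0 T)) :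
    trackingCost K 0 μ T (a - b) (u - v) = 2 * trackingCost K y μ T a u
      + 2 * trackingCost K y μ T b v
      - 4 * trackingCost K y μ T ((2⁻¹ : ℝ) • a + (2⁻¹ : ℝ) • b)
          ((2⁻¹ : ℝ) • u + (2⁻¹ : ℝ) • v) := by
  have ii {f : ℝ → ℝ} (hf : ContinuousOn f (Set.Icc 0 T)) : IntervalIntegrable f volume 0 T :=
    hf.intervalIntegrable_of_Icc hT
  have hua := ii (continuousOn_trackingCost (K := K) (μ := μ) ha hu hy)
  have hvb := ii (continuousOn_trackingCost (K := K) (μ := μ) hb hv hy)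
  have hmid := ii (continuousOn_trackingCost (K := K) (μ := μ)
    ((ha.const_smul (2⁻¹ : ℝ)).add (hb.const_smul (2⁻¹ : ℝ)))
    ((hu.const_smul (2⁻¹ : ℝ)).add (hv.const_smul (2⁻¹ : ℝ))) hy)
  simp only [trackingCost]
  rw [← intervalIntegral.integral_const_mul, ← intervalIntegral.integral_const_mul,
    ← intervalIntegral.integral_const_mul,
    ← intervalIntegral.integral_add (hua.const_mul _) (hvb.const_mul _),
    ← intervalIntegral.integral_sub ((hua.const_mul _).add (hvb.const_mul _)) (hmid.const_mul _)]
  refine intervalIntegral.integral_congr fun t _ => ?_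
  have hdiff : K *ᵥ (a t - b t) - 0 = (K *ᵥ a t - y t) - (K *ᵥ b t - y t) := by
    rw [mulVec_sub]; abel
  have hmean : K *ᵥ ((2⁻¹ : ℝ) • a t + (2⁻¹ : ℝ) • b t) - y t
      = (2⁻¹ : ℝ) • (K *ᵥ a t - y t) + (2⁻¹ : ℝ) • (K *ᵥ b t - y t) := by
    rw [mulVec_add, mulVec_smul, mulVec_smul]; module
  simp only [Pi.add_apply, Pi.sub_apply, Pi.smul_apply, Pi.zero_apply, hdiff, hmean]
  generalize K *ᵥ a t - y t = e
  generalize K *ᵥ b t - y t = k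
  simp only [add_dotProduct, dotProduct_add, sub_dotProduct, dotProduct_sub, smul_dotProduct,
    dotProduct_smul, smul_eq_mul, dotProduct_comm k e, dotProduct_comm (v t) (u t)]
  ring

/-- The pair of a continuous control `u` and its state `a` minimizes the tracking cost. -/
def IsTrackingMinimizer (M : Matrix ι ι ℝ) (N : Matrix ι κ ℝ) (K : Matrix ρ ι ℝ)
    (y : ℝ → ρ → ℝ) (μ T : ℝ) (a₀ : ι → ℝ) (a : ℝ → ι → ℝ) (u : ℝ → κ → ℝ) : Prop :=
  ∀ v : ℝ → κ → ℝ, ContinuousOn v (Set.Icc 0 T) → ∀ b : ℝ → ι → ℝ, b 0 = a₀ →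
    (∀ t ∈ Set.Icc 0 T, HasDerivAt b (M *ᵥ b t + N *ᵥ v t) t) →
    trackingCost K y μ T a u ≤ trackingCost K y μ T b v

/-- First-order optimality characterizes the minimizers of the tracking cost. -/
theorem isTrackingMinimizer_iff (hT : 0 < T) (hμ : 0 < μ) (hy : ContinuousOn y (Set.Icc 0 T))
    {a₀ : ι → ℝ} {a l : ℝ → ι → ℝ} {u : ℝ → κ → ℝ} (hu : ContinuousOn u (Set.Icc 0 T))
    (ha0 : a 0 = a₀) (ha : ∀ t ∈ Set.Icc 0 T, HasDerivAt a (M *ᵥ a t + N *ᵥ u t) t)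
    (hlT : l T = 0)
    (hl : ∀ t ∈ Set.Icc 0 T, HasDerivAt l (-(Mᵀ *ᵥ l t + Kᵀ *ᵥ (K *ᵥ a t - y t))) t) :
    IsTrackingMinimizer M N K y μ T a₀ a u ↔ ∀ t ∈ Set.Icc 0 T, μ • u t + Nᵀ *ᵥ l t = 0 := by
  have hac : ContinuousOn a (Set.Icc 0 T) := fun t ht => (ha t ht).continuousAt.continuousWithinAt
  have hlc : ContinuousOn l (Set.Icc 0 T) := fun t ht => (hl t ht).continuousAt.continuousWithinAt
  have hg : ContinuousOn (fun t => μ • u t + Nᵀ *ᵥ l t) (Set.Icc 0 T) :=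
    (hu.const_smul μ).add (hlc.const_mulVec Nᵀ)
  constructor
  · intro hmin
    let g : ℝ → κ → ℝ := Set.IccExtend hT.le
      ((Set.Icc 0 T).domRestrict fun t => μ • u t + Nᵀ *ᵥ l t)
    have hgc : Continuous g := hg.domRestrict.Icc_extend'
    have hgeq : ∀ t ∈ Set.Icc 0 T, g t = μ • u t + Nᵀ *ᵥ l t := fun t ht =>
      Set.IccExtend_of_mem hT.le _ ht
    obtain ⟨d, hd0, hd⟩ := exists_hasDerivAt_linear_ode (Matrix.mulVecLin M).toContinuousLinearMap
      (continuous_const.matrix_mulVec hgc : Continuous fun t => N *ᵥ g t)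
    replace hd : ∀ t, HasDerivAt d (M *ᵥ d t + N *ᵥ g t) t := hd
    set I := ∫ t in (0 : ℝ)..T, (μ • u t + Nᵀ *ᵥ l t) ⬝ᵥ g t with hI
    set Q := trackingCost K 0 μ T d g
    have hpoly : ∀ s : ℝ, 0 ≤ 2 * s * I + s ^ 2 * Q := by
      intro s
      have hle := hmin (u + s • g) (hu.add (hgc.continuousOn.const_smul s)) (a + s • d)
        (by simp [ha0, hd0]) fun t ht => by
          simpa using (ha t ht).linear_ode_add_smul 1 s (hd t)
      rw [trackingCost_add_smul hT.le hy hu hgc.continuousOn hac hd0 (fun t _ => hd t) hlT hl s]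
        at hle
      linarith
    have hQ : 0 ≤ Q := trackingCost_zero_nonneg hμ.le hT.le d g
    have hI0 : I ≤ 0 := by
      by_contra! hpos
      have := hpoly (-(I / (Q + 1)))
      have hQ1 : 0 < Q + 1 := by linarith
      have hval : 2 * (-(I / (Q + 1))) * I + (-(I / (Q + 1))) ^ 2 * Q
          = -((I / (Q + 1)) ^ 2 * (Q + 2)) := by
        field_simp
        ring
      rw [hval] at this
      have : 0 < (I / (Q + 1)) ^ 2 * (Q + 2) := by positivity
      linarith
    have hzero := (hg.dotProduct_real hgc.continuousOn).eq_zero_of_integral_nonpos hT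
      (fun t ht => by rw [hgeq t ht]; exact dotProduct_self_nonneg_real _) hI0
    intro t ht
    have := hzero t ht
    rwa [hgeq t ht, dotProduct_self_eq_zero] at this
  · intro hopt v hv b hb0 hb
    have hd (t : ℝ) (ht : t ∈ Set.Icc 0 T) :
        HasDerivAt (b - a) (M *ᵥ (b - a) t + N *ᵥ (v - u) t) t := by
      simpa [sub_eq_add_neg] using (hb t ht).linear_ode_add_smul 1 (-1) (ha t ht)
    have hexpand := trackingCost_add_smul (μ := μ) hT.le hy hu (hv.sub hu) hac
      (by simp [ha0, hb0]) hd hlT hl 1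
    have hI : ∫ t in (0 : ℝ)..T, (μ • u t + Nᵀ *ᵥ l t) ⬝ᵥ (v - u) t = 0 := by
      refine intervalIntegral.integral_zero_ae (Filter.Eventually.of_forall fun t ht => ?_)
      rw [Set.uIoc_of_le hT.le] at ht
      rw [hopt t (Set.Ioc_subset_Icc_self ht), zero_dotProduct]
    have hQ := trackingCost_zero_nonneg (K := K) hμ.le hT.le (b - a) (v - u)
    rw [hI, one_smul, one_smul, add_sub_cancel, add_sub_cancel] at hexpand
    linarith

/-- Minimizing controls of the tracking cost are unique. -/
theorem IsTrackingMinimizer.control_eq (hT : 0 < T) (hμ : 0 < μ)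
    (hy : ContinuousOn y (Set.Icc 0 T)) {a₀ : ι → ℝ} {a b : ℝ → ι → ℝ} {u v : ℝ → κ → ℝ}
    (hu : ContinuousOn u (Set.Icc 0 T)) (hv : ContinuousOn v (Set.Icc 0 T)) (ha0 : a 0 = a₀)
    (ha : ∀ t ∈ Set.Icc 0 T, HasDerivAt a (M *ᵥ a t + N *ᵥ u t) t) (hb0 : b 0 = a₀)
    (hb : ∀ t ∈ Set.Icc 0 T, HasDerivAt b (M *ᵥ b t + N *ᵥ v t) t)
    (hmin_a : IsTrackingMinimizer M N K y μ T a₀ a u)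
    (hmin_b : IsTrackingMinimizer M N K y μ T a₀ b v) :
    ∀ t ∈ Set.Icc 0 T, u t = v t := by
  have hac : ContinuousOn a (Set.Icc 0 T) := fun t ht => (ha t ht).continuousAt.continuousWithinAt
  have hbc : ContinuousOn b (Set.Icc 0 T) := fun t ht => (hb t ht).continuousAt.continuousWithinAt
  have hmc : ContinuousOn ((2⁻¹ : ℝ) • u + (2⁻¹ : ℝ) • v) (Set.Icc 0 T) :=
    (hu.const_smul _).add (hv.const_smul _)
  have hm0 : ((2⁻¹ : ℝ) • a + (2⁻¹ : ℝ) • b) 0 = a₀ := by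
    simp only [Pi.add_apply, Pi.smul_apply, ha0, hb0]
    module
  have hmd (t : ℝ) (ht : t ∈ Set.Icc 0 T) := (ha t ht).linear_ode_add_smul 2⁻¹ 2⁻¹ (hb t ht)
  have hle_a := hmin_a _ hmc _ hm0 hmd
  have hle_b := hmin_b _ hmc _ hm0 hmd
  have hmid := trackingCost_midpoint (K := K) (μ := μ) hT.le hy hu hv hac hbc
  have hzero := (continuousOn_trackingCost (K := K) (μ := μ) (y := 0) (hac.sub hbc) (hu.sub hv)
    continuousOn_const).eq_zero_of_integral_nonpos hT
    (fun t _ => add_nonneg (dotProduct_self_nonneg_real _)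
      (mul_nonneg hμ.le (dotProduct_self_nonneg_real _)))
    (show trackingCost K 0 μ T (a - b) (u - v) ≤ 0 by linarith)
  intro t ht
  have hsum := (add_eq_zero_iff_of_nonneg (dotProduct_self_nonneg_real _)
    (mul_nonneg hμ.le (dotProduct_self_nonneg_real _))).1 (hzero t ht)
  exact sub_eq_zero.1 (dotProduct_self_eq_zero.1 ((mul_eq_zero.1 hsum.2).resolve_left hμ.ne'))

end LinearQuadratic

/-- A control `u*` is a global minimizer of the POD-Galerkin
reduced cost `J_r` if and only if `μ u*(t) + Bᵀ U a_{λ,u*}(t) = 0` for every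
`t ∈ [0, t_f]`; moreover, there is at most one such minimizer among continuous
controls. -/
theorem podg_global_min_iff_optimality_and_unique
    (m nc pdim : ℕ) (t_f : ℝ) (ht_f : 0 < t_f)
    (A : Matrix (Fin m) (Fin m) ℝ) (B : Matrix (Fin m) (Fin nc) ℝ)
    (C : Matrix (Fin m) (Fin m) ℝ) (μ : ℝ) (hμ : 0 < μ)
    (q0 : Fin m → ℝ) (qd : ℝ → Fin m → ℝ)
    (hqd : ContinuousOn qd (Set.Icc (0:ℝ) t_f))
    -- the POD basis with orthonormal columns
    (U : Matrix (Fin m) (Fin pdim) ℝ) (hU : Uᵀ * U = 1)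
    -- the control `u*`, its reduced state and its reduced adjoint
    (ustar : ℝ → Fin nc → ℝ)
    (hustar : ContinuousOn ustar (Set.Icc (0:ℝ) t_f))
    (astar : ℝ → Fin pdim → ℝ)
    (hastar0 : astar 0 = Uᵀ *ᵥ q0)
    (hastarode : ∀ t ∈ Set.Icc (0:ℝ) t_f,
      HasDerivAt astar ((Uᵀ * A * U) *ᵥ astar t + (Uᵀ * B) *ᵥ ustar t) t)
    (alam : ℝ → Fin pdim → ℝ)
    (halamf : alam t_f = 0)
    (halamode : ∀ t ∈ Set.Icc (0:ℝ) t_f,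
      HasDerivAt alam
        (-((Uᵀ * Aᵀ * U) *ᵥ alam t + (Uᵀ * (Cᵀ * C)) *ᵥ (U *ᵥ astar t - qd t))) t) :
    -- `u*` is a global minimizer of `J_r` iff the optimality condition holds
    ((∀ v : ℝ → Fin nc → ℝ, ContinuousOn v (Set.Icc (0:ℝ) t_f) →
        ∀ av : ℝ → Fin pdim → ℝ, av 0 = Uᵀ *ᵥ q0 →
        (∀ t ∈ Set.Icc (0:ℝ) t_f,
          HasDerivAt av ((Uᵀ * A * U) *ᵥ av t + (Uᵀ * B) *ᵥ v t) t) →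
        (1/2) * (∫ t in (0:ℝ)..t_f,
            ((C *ᵥ (U *ᵥ astar t - qd t)) ⬝ᵥ (C *ᵥ (U *ᵥ astar t - qd t))
              + μ * (ustar t ⬝ᵥ ustar t)))
          ≤ (1/2) * (∫ t in (0:ℝ)..t_f,
            ((C *ᵥ (U *ᵥ av t - qd t)) ⬝ᵥ (C *ᵥ (U *ᵥ av t - qd t))
              + μ * (v t ⬝ᵥ v t))))
      ↔ (∀ t ∈ Set.Icc (0:ℝ) t_f, μ • ustar t + Bᵀ *ᵥ (U *ᵥ alam t) = 0)) ∧
    -- at most one global minimizer among continuous controls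
    (∀ u1 u2 : ℝ → Fin nc → ℝ,
      ContinuousOn u1 (Set.Icc (0:ℝ) t_f) → ContinuousOn u2 (Set.Icc (0:ℝ) t_f) →
      ∀ a1 : ℝ → Fin pdim → ℝ, a1 0 = Uᵀ *ᵥ q0 →
      (∀ t ∈ Set.Icc (0:ℝ) t_f,
        HasDerivAt a1 ((Uᵀ * A * U) *ᵥ a1 t + (Uᵀ * B) *ᵥ u1 t) t) →
      ∀ a2 : ℝ → Fin pdim → ℝ, a2 0 = Uᵀ *ᵥ q0 →
      (∀ t ∈ Set.Icc (0:ℝ) t_f,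
        HasDerivAt a2 ((Uᵀ * A * U) *ᵥ a2 t + (Uᵀ * B) *ᵥ u2 t) t) →
      (∀ v : ℝ → Fin nc → ℝ, ContinuousOn v (Set.Icc (0:ℝ) t_f) →
        ∀ av : ℝ → Fin pdim → ℝ, av 0 = Uᵀ *ᵥ q0 →
        (∀ t ∈ Set.Icc (0:ℝ) t_f,
          HasDerivAt av ((Uᵀ * A * U) *ᵥ av t + (Uᵀ * B) *ᵥ v t) t) →
        (1/2) * (∫ t in (0:ℝ)..t_f,
            ((C *ᵥ (U *ᵥ a1 t - qd t)) ⬝ᵥ (C *ᵥ (U *ᵥ a1 t - qd t))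
              + μ * (u1 t ⬝ᵥ u1 t)))
          ≤ (1/2) * (∫ t in (0:ℝ)..t_f,
            ((C *ᵥ (U *ᵥ av t - qd t)) ⬝ᵥ (C *ᵥ (U *ᵥ av t - qd t))
              + μ * (v t ⬝ᵥ v t)))) →
      (∀ v : ℝ → Fin nc → ℝ, ContinuousOn v (Set.Icc (0:ℝ) t_f) →
        ∀ av : ℝ → Fin pdim → ℝ, av 0 = Uᵀ *ᵥ q0 →
        (∀ t ∈ Set.Icc (0:ℝ) t_f,
          HasDerivAt av ((Uᵀ * A * U) *ᵥ av t + (Uᵀ * B) *ᵥ v t) t) →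
        (1/2) * (∫ t in (0:ℝ)..t_f,
            ((C *ᵥ (U *ᵥ a2 t - qd t)) ⬝ᵥ (C *ᵥ (U *ᵥ a2 t - qd t))
              + μ * (u2 t ⬝ᵥ u2 t)))
          ≤ (1/2) * (∫ t in (0:ℝ)..t_f,
            ((C *ᵥ (U *ᵥ av t - qd t)) ⬝ᵥ (C *ᵥ (U *ᵥ av t - qd t))
              + μ * (v t ⬝ᵥ v t)))) →
      ∀ t ∈ Set.Icc (0:ℝ) t_f, u1 t = u2 t) := by
  have hy : ContinuousOn (fun t => C *ᵥ qd t) (Set.Icc 0 t_f) := hqd.const_mulVec C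
  have hres (x : Fin pdim → ℝ) (z : Fin m → ℝ) :
      C *ᵥ (U *ᵥ x - z) = (C * U) *ᵥ x - C *ᵥ z := by
    rw [mulVec_sub, mulVec_mulVec]
  have hl (t : ℝ) (ht : t ∈ Set.Icc 0 t_f) : HasDerivAt alam
      (-((Uᵀ * A * U)ᵀ *ᵥ alam t + (C * U)ᵀ *ᵥ ((C * U) *ᵥ astar t - C *ᵥ qd t))) t := by
    refine (halamode t ht).congr_deriv ?_
    rw [← hres, mulVec_mulVec]
    simp only [transpose_mul, transpose_transpose, Matrix.mul_assoc]
  have hgrad (t : ℝ) : Bᵀ *ᵥ (U *ᵥ alam t) = (Uᵀ * B)ᵀ *ᵥ alam t := by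
    rw [mulVec_mulVec, transpose_mul, transpose_transpose]
  simp only [hres, hgrad, mul_le_mul_iff_right₀ (one_half_pos (α := ℝ))]
  refine ⟨isTrackingMinimizer_iff ht_f hμ hy hustar hastar0 hastarode halamf hl, ?_⟩
  intro u1 u2 hu1 hu2 a1 ha10 ha1 a2 ha20 ha2 hmin1 hmin2
  exact IsTrackingMinimizer.control_eq ht_f hμ hy hu1 hu2 ha10 ha1 ha20 ha2 hmin1 hmin2
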